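/- Fix positive integers t ≤ m ≤ n, let X be an m×n matrix of indeterminates over a field 𝔽 of prime characteristic p, R = 𝔽[X], and I_t the ideal of t×t minors of X. Let k be the least integer in [0, t−1] with (m−k)(n−k)/(t−k) ≤ (m−k−1)(n−k−1)/(t−k−1) (division by zero interpreted as infinity), and let Δ be defined from Δ_k, Δ_k' and u = t(m+n−2k) − mn + k² as in the construction below. Then Δ has degree t(m−k)(n−k), Δ is a product of at most (m−k)(n−k) minors of X, and Δ lies in the integral closure of the ideal I_t^{(m−k)(n−k)}. -/

import Mathlib

open MvPolynomial

/-- The generic `m × n` matrix `X`, whose entries are the variables `x_{ij}` of the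
polynomial ring `𝔽[X]`. -/
noncomputable def genMat (𝔽 : Type*) [Field 𝔽] (m n : ℕ) :
    Matrix (Fin m) (Fin n) (MvPolynomial (Fin m × Fin n) 𝔽) :=
  Matrix.of fun i j => MvPolynomial.X (i, j)

/-- `f` is a size `s` minor of the generic `m × n` matrix: the determinant of the submatrix
obtained by choosing `s` rows and `s` columns (in increasing order). -/
def IsMinor (𝔽 : Type*) [Field 𝔽] (m n s : ℕ) (f : MvPolynomial (Fin m × Fin n) 𝔽) : Prop :=
  ∃ (row : Fin s → Fin m) (col : Fin s → Fin n), StrictMono row ∧ StrictMono col ∧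
    f = ((genMat 𝔽 m n).submatrix row col).det

/-- `I_s ⊆ 𝔽[X]`, the ideal generated by the size `s` minors of the generic matrix. -/
noncomputable def minorsIdeal (𝔽 : Type*) [Field 𝔽] (m n s : ℕ) :
    Ideal (MvPolynomial (Fin m × Fin n) 𝔽) :=
  Ideal.span {f | IsMinor 𝔽 m n s f}

/-- `x` lies in the integral closure of the ideal `J`: it satisfies an equation
`x^d + a_1 x^{d-1} + ⋯ + a_d = 0` with `a_i ∈ J^i`. -/
def MemIntClosure {R : Type*} [CommRing R] (J : Ideal R) (x : R) : Prop :=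
  ∃ (d : ℕ) (a : ℕ → R), 0 < d ∧ (∀ i ∈ Finset.Icc 1 d, a i ∈ J ^ i) ∧
    x ^ d + ∑ i ∈ Finset.Icc 1 d, a i * x ^ (d - i) = 0

/-- The minor of the generic `m × n` matrix with the `s` consecutive rows
`r0+1, …, r0+s` and the `s` consecutive columns `c0+1, …, c0+s` (in `1`-based terms).
Indices are clamped into range; in all uses below they are within range, so this is
exactly the minor `[r0+1,…,r0+s | c0+1,…,c0+s]`. -/
noncomputable def intervalMinor (𝔽 : Type*) [Field 𝔽] (m n : ℕ) (s r0 c0 : ℕ) :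
    MvPolynomial (Fin m × Fin n) 𝔽 :=
  if h : 0 < m ∧ 0 < n then
    (Matrix.of fun i j : Fin s =>
      (MvPolynomial.X (⟨min (r0 + (i : ℕ)) (m - 1), by omega⟩,
        ⟨min (c0 + (j : ℕ)) (n - 1), by omega⟩) : MvPolynomial (Fin m × Fin n) 𝔽)).det
  else 0

/-- The element `Δ_k`, the product of the minors
`[1,…,m | i,…,i+m-1]` for `i = 1, …, n-m+1`, and
`[j,…,m | 1,…,m-j+1]·[1,…,m-j+1 | n-m+j,…,n]` for `j = 2, …, m-k`. -/
noncomputable def Delta (𝔽 : Type*) [Field 𝔽] (m n k : ℕ) :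
    MvPolynomial (Fin m × Fin n) 𝔽 :=
  (∏ i ∈ Finset.range (n - m + 1), intervalMinor 𝔽 m n m 0 i) *
    ∏ j ∈ Finset.Icc 2 (m - k),
      intervalMinor 𝔽 m n (m - j + 1) (j - 1) 0 *
        intervalMinor 𝔽 m n (m - j + 1) 0 (n - m + j - 1)

/-- The element `Δ_k' = Δ_k · [m-k+1,…,m | 1,…,k]` (for `k ≥ 1`). -/
noncomputable def Delta' (𝔽 : Type*) [Field 𝔽] (m n k : ℕ) :
    MvPolynomial (Fin m × Fin n) 𝔽 :=
  Delta 𝔽 m n k * intervalMinor 𝔽 m n k (m - k) 0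

/-- The integer `u = t(m+n-2k) - mn + k²`. -/
def uInt (t m n k : ℕ) : ℤ :=
  (t : ℤ) * ((m : ℤ) + (n : ℤ) - 2 * (k : ℤ)) - (m : ℤ) * (n : ℤ) + (k : ℤ) ^ 2

/-- The element `Δ`:  `Δ_0^t` if `k = 0`;  `Δ_k^u · (Δ_k')^{t-k-u}` if `k ≥ 1` and `u ≥ 0`;
and `(Δ_k')^{t-k+u} · Δ_{k-1}^{-u}` if `k ≥ 1` and `u < 0`. -/
noncomputable def DeltaMain (𝔽 : Type*) [Field 𝔽] (m n t k : ℕ) :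
    MvPolynomial (Fin m × Fin n) 𝔽 :=
  if k = 0 then Delta 𝔽 m n 0 ^ t
  else if 0 ≤ uInt t m n k then
    Delta 𝔽 m n k ^ (uInt t m n k).toNat *
      Delta' 𝔽 m n k ^ ((t : ℤ) - (k : ℤ) - uInt t m n k).toNat
  else
    Delta' 𝔽 m n k ^ ((t : ℤ) - (k : ℤ) + uInt t m n k).toNat *
      Delta 𝔽 m n (k - 1) ^ (-uInt t m n k).toNat

/-- The condition `(m-k)(n-k)/(t-k) ≤ (m-k-1)(n-k-1)/(t-k-1)`, where a positive integer
divided by zero is interpreted as infinity: for `k = t-1` the right-hand side is infinite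
and the condition holds automatically. -/
def minCond (t m n k : ℕ) : Prop :=
  k = t - 1 ∨
    (((m - k) * (n - k) : ℕ) : ℝ) / ((t - k : ℕ) : ℝ) ≤
      (((m - k - 1) * (n - k - 1) : ℕ) : ℝ) / ((t - k - 1 : ℕ) : ℝ)

/-- The ideal generated by the size `s` minors of a matrix, where rows and columns may be chosen
in any order and with repetitions. -/
def Matrix.detIdeal {ι κ A : Type*} [CommRing A] (M : Matrix ι κ A) (s : ℕ) : Ideal A :=
  Ideal.span (Set.range fun q : (Fin s → ι) × (Fin s → κ) => (M.submatrix q.1 q.2).det)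

namespace Matrix

variable {ι κ A : Type*} [CommRing A]

theorem det_submatrix_mem_detIdeal (M : Matrix ι κ A) {s : ℕ} (r : Fin s → ι) (c : Fin s → κ) :
    (M.submatrix r c).det ∈ M.detIdeal s :=
  Ideal.subset_span ⟨(r, c), rfl⟩

theorem detIdeal_mul_left_le [Fintype ι] {ι' : Type*} (P : Matrix ι' ι A) (M : Matrix ι κ A)
    (s : ℕ) : (P * M).detIdeal s ≤ M.detIdeal s := by
  classical
  refine Ideal.span_le.2 ?_
  rintro _ ⟨⟨r, c⟩, rfl⟩
  have h : ((P * M).submatrix r c).det =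
      (detRowAlternating (n := Fin s) (R := A)).toMultilinearMap
        (fun i => ∑ k, P (r i) k • fun j => M k (c j)) := by
    change det _ = det _
    congr 1
    ext i j
    simp [mul_apply]
  simp only [h, SetLike.mem_coe]
  rw [MultilinearMap.map_sum]
  refine Ideal.sum_mem _ fun f _ => ?_
  rw [MultilinearMap.map_smul_univ]
  exact Ideal.mul_mem_left _ _ (det_submatrix_mem_detIdeal M f c)

theorem detIdeal_transpose_le (M : Matrix ι κ A) (s : ℕ) : Mᵀ.detIdeal s ≤ M.detIdeal s := by
  refine Ideal.span_le.2 ?_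
  rintro _ ⟨⟨r, c⟩, rfl⟩
  simp only [SetLike.mem_coe]
  rw [← det_transpose]
  exact det_submatrix_mem_detIdeal M c r

theorem detIdeal_mul_right_le [Fintype κ] {κ' : Type*} (M : Matrix ι κ A) (Q : Matrix κ κ' A)
    (s : ℕ) : (M * Q).detIdeal s ≤ M.detIdeal s :=
  calc (M * Q).detIdeal s = ((Qᵀ * Mᵀ)ᵀ).detIdeal s := by
        rw [transpose_mul, transpose_transpose, transpose_transpose]
    _ ≤ (Qᵀ * Mᵀ).detIdeal s := detIdeal_transpose_le _ s
    _ ≤ Mᵀ.detIdeal s := detIdeal_mul_left_le _ _ s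
    _ ≤ M.detIdeal s := detIdeal_transpose_le _ s

theorem detIdeal_le_of_rowOp [Fintype ι] (M M' : Matrix ι κ A) (i₀ : ι) (q : ι → A)
    (h : ∀ i j, M' i j = M i j + q i * M i₀ j) (s : ℕ) : M'.detIdeal s ≤ M.detIdeal s := by
  classical
  have : M' = (1 + of fun i k => if k = i₀ then q i else 0) * M := by
    rw [Matrix.add_mul, Matrix.one_mul]
    ext i j
    rw [add_apply, h, mul_apply]
    simp
  rw [this]
  exact detIdeal_mul_left_le _ _ s

theorem detIdeal_le_of_colOp [Fintype κ] (M M' : Matrix ι κ A) (j₀ : κ) (q : κ → A)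
    (h : ∀ i j, M' i j = M i j + q j * M i j₀) (s : ℕ) : M'.detIdeal s ≤ M.detIdeal s := by
  classical
  have : M' = M * (1 + of fun k j => if k = j₀ then q j else 0) := by
    rw [Matrix.mul_add, Matrix.mul_one]
    ext i j
    rw [add_apply, h, mul_apply]
    simp [mul_comm]
  rw [this]
  exact detIdeal_mul_right_le _ _ s

theorem detIdeal_eq_of_rowOp [Fintype ι] (M M' : Matrix ι κ A) (i₀ : ι) (q : ι → A)
    (hq : q i₀ = 0) (h : ∀ i j, M' i j = M i j + q i * M i₀ j) (s : ℕ) :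
    M'.detIdeal s = M.detIdeal s :=
  le_antisymm (detIdeal_le_of_rowOp M M' i₀ q h s)
    (detIdeal_le_of_rowOp M' M i₀ (-q) (fun i j => by simp [h, hq]) s)

theorem detIdeal_eq_of_colOp [Fintype κ] (M M' : Matrix ι κ A) (j₀ : κ) (q : κ → A)
    (hq : q j₀ = 0) (h : ∀ i j, M' i j = M i j + q j * M i j₀) (s : ℕ) :
    M'.detIdeal s = M.detIdeal s :=
  le_antisymm (detIdeal_le_of_colOp M M' j₀ q h s)
    (detIdeal_le_of_colOp M' M j₀ (-q) (fun i j => by simp [h, hq]) s)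

/-- The row `i` has at most one nonzero entry, and this entry is the only nonzero one in
its column. -/
def IsolatedRow (M : Matrix ι κ A) (i : ι) : Prop :=
  ∀ j, M i j ≠ 0 → (∀ j', j' ≠ j → M i j' = 0) ∧ ∀ i', i' ≠ i → M i' j = 0

theorem exists_dvd_of_finset {B σ : Type*} [CommRing B] [IsDomain B] [ValuationRing B]
    (f : σ → B) (S : Finset σ) (hS : S.Nonempty) : ∃ x ∈ S, ∀ y ∈ S, f x ∣ f y := by
  classical
  obtain ⟨x, hx, h⟩ := S.exists_max_image (fun i => Ideal.span {f i}) hS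
  exact ⟨x, hx, fun y hy => Ideal.span_singleton_le_span_singleton.1 (h y hy)⟩

/-- Over a valuation ring, a matrix can be diagonalized without changing its ideals of minors. -/
theorem exists_isolatedRow_detIdeal_eq [Fintype ι] [Fintype κ] [IsDomain A] [ValuationRing A]
    (M : Matrix ι κ A) :
    ∃ D : Matrix ι κ A, (∀ i, D.IsolatedRow i) ∧ ∀ s, D.detIdeal s = M.detIdeal s := by
  classical
  suffices H : ∀ (S : Finset ι) (M : Matrix ι κ A), (∀ i ∉ S, M.IsolatedRow i) →
      ∃ D : Matrix ι κ A, (∀ i, D.IsolatedRow i) ∧ ∀ s, D.detIdeal s = M.detIdeal s from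
    H Finset.univ M (by simp)
  intro S
  induction S using Finset.strongInduction with
  | H S ih =>
  intro M hM
  by_cases h0 : ∀ i ∈ S, ∀ j, M i j = 0
  · refine ⟨M, fun i => ?_, fun _ => rfl⟩
    by_cases hi : i ∈ S
    · exact fun j hj => (hj (h0 i hi j)).elim
    · exact hM i hi
  push Not at h0
  obtain ⟨i₁, hi₁, j₁, h₁⟩ := h0
  obtain ⟨⟨i₀, j₀⟩, hmem, hdvd⟩ := exists_dvd_of_finset (fun x : ι × κ => M x.1 x.2)
    (S ×ˢ Finset.univ) ⟨(i₁, j₁), by simp [hi₁]⟩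
  have hi₀ : i₀ ∈ S := by simpa using hmem
  have hdvd' : ∀ i ∈ S, ∀ j, M i₀ j₀ ∣ M i j := fun i hi j => hdvd (i, j) (by simp [hi])
  have ha : M i₀ j₀ ≠ 0 := fun h => h₁ (zero_dvd_iff.1 (h ▸ hdvd' i₁ hi₁ j₁))
  have hcol : ∀ i ∉ S, M i j₀ = 0 := fun i hi => by
    by_contra h
    exact ha ((hM i hi j₀ h).2 i₀ (fun e => hi (e ▸ hi₀)))
  have hq : ∀ i, ∃ q, M i j₀ = M i₀ j₀ * q := fun i => by
    by_cases hi : i ∈ S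
    · exact hdvd' i hi j₀
    · exact ⟨0, by simp [hcol i hi]⟩
  choose q hq using hq
  choose r hr using hdvd' i₀ hi₀
  have hq0 : ∀ i ∉ S, q i = 0 := fun i hi => by
    simpa [hcol i hi, ha] using (hq i).symm
  let M₁ : Matrix ι κ A := of fun i j => M i j + (if i = i₀ then 0 else - q i) * M i₀ j
  let M₂ : Matrix ι κ A := of fun i j => M₁ i j + (if j = j₀ then 0 else - r j) * M₁ i j₀
  have e₁ : ∀ i, M₁ i j₀ = if i = i₀ then M i₀ j₀ else 0 := fun i => by
    by_cases h : i = i₀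
    · simp [M₁, h]
    · simp [M₁, h]
      rw [hq i]; ring
  have e₂ : ∀ i j, M₂ i j = if i = i₀ then (if j = j₀ then M i₀ j₀ else 0)
      else M i j - q i * M i₀ j := fun i j => by
    by_cases h : i = i₀
    · by_cases h' : j = j₀
      · simp [M₂, e₁, h, h']
      · simp only [M₂, of_apply, e₁, h, h', if_true, if_false]
        simp only [M₁, of_apply, if_true]
        rw [hr j]; ring
    · simp only [M₂, of_apply, e₁, h, if_false, mul_zero, add_zero]
      simp [M₁, h, sub_eq_add_neg]
  obtain ⟨D, hD, hD'⟩ := ih (S.erase i₀) (Finset.erase_ssubset hi₀) M₂ (by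
    intro i hi j hj
    by_cases h : i = i₀
    · subst h
      have hj₀ : j = j₀ := by
        by_contra h'
        exact hj (by simp [e₂, h'])
      subst hj₀
      refine ⟨fun j' hj' => by simp [e₂, hj'], fun i' hi' => ?_⟩
      simp only [e₂, hi', if_false]
      rw [hq i']; ring
    · have hiS : i ∉ S := fun h' => hi (Finset.mem_erase.2 ⟨h, h'⟩)
      have hrow : ∀ j, M₂ i j = M i j := fun j => by simp [e₂, h, hq0 i hiS]
      rw [hrow] at hj
      obtain ⟨h1, h2⟩ := hM i hiS j hj
      refine ⟨fun j' hj' => by rw [hrow, h1 j' hj'], fun i' hi' => ?_⟩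
      have hjj : j ≠ j₀ := fun e => hj (e ▸ hcol i hiS)
      by_cases h' : i' = i₀
      · simp [e₂, h', hjj]
      · simp [e₂, h', h2 i' hi', h2 i₀ (Ne.symm h)])
  refine ⟨D, hD, fun s => ?_⟩
  rw [hD', detIdeal_eq_of_colOp M₁ M₂ j₀ (fun j => if j = j₀ then 0 else - r j) (by simp)
    (fun _ _ => rfl), detIdeal_eq_of_rowOp M M₁ i₀ (fun i => if i = i₀ then 0 else - q i) (by simp)
    (fun _ _ => rfl)]

end Matrix

theorem Finset.prod_mul_pow_card_dvd {ι A : Type*} [CommMonoid A] [Fintype ι]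
    (d : ι → A) (c : A) (S T : Finset ι) (hS : ∀ i ∈ T, d i ∣ c) (hT : ∀ i ∉ T, c ∣ d i) :
    (∏ i ∈ T, d i) * c ^ S.card ∣ (∏ i ∈ S, d i) * c ^ T.card := by
  classical
  have key : ∀ U V : Finset ι, (∏ i ∈ U, d i) * c ^ V.card =
      ∏ i, (if i ∈ U then d i else 1) * (if i ∈ V then c else 1) := fun U V => by
    rw [Finset.prod_mul_distrib, Finset.prod_ite_mem, Finset.prod_ite_mem]
    simp
  rw [key, key]
  refine Finset.prod_dvd_prod_of_dvd _ _ fun i _ => ?_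
  by_cases h1 : i ∈ T <;> by_cases h2 : i ∈ S <;> simp [h1, h2, hS, hT]

namespace Matrix

variable {A : Type*} [CommRing A]

theorem IsolatedRow.prod_dvd_det {ι κ : Type*} [Fintype κ] {D : Matrix ι κ A}
    (hD : ∀ i, D.IsolatedRow i) {s : ℕ} (r : Fin s → ι) (c : Fin s → κ) :
    ∏ i, ∑ j, D (r i) j ∣ (D.submatrix r c).det := by
  rw [det_apply]
  refine Finset.dvd_sum fun σ _ => ?_
  rw [Units.smul_def, zsmul_eq_mul]
  refine Dvd.dvd.mul_left ?_ _
  rw [← Equiv.prod_comp σ]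
  refine Finset.prod_dvd_prod_of_dvd _ _ fun i _ => ?_
  by_cases h : D (r (σ i)) (c i) = 0
  · simp [h]
  · rw [Finset.sum_eq_single (c i) (fun j _ hj => (hD _ _ h).1 j hj) (by simp)]
    rfl

theorem IsolatedRow.prod_mem_detIdeal {ι κ : Type*} [Fintype κ] {D : Matrix ι κ A}
    (hD : ∀ i, D.IsolatedRow i) {s : ℕ} (r : Fin s → ι) (hr : r.Injective) :
    ∏ i, ∑ j, D (r i) j ∈ D.detIdeal s := by
  classical
  by_cases h0 : ∃ i, ∀ j, D (r i) j = 0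
  · obtain ⟨i, hi⟩ := h0
    rw [Finset.prod_eq_zero (Finset.mem_univ i) (by simp [hi])]
    exact zero_mem _
  push Not at h0
  choose c hc using h0
  have : D.submatrix r c = diagonal fun i => ∑ j, D (r i) j := by
    ext i i'
    by_cases h : i = i'
    · subst h
      rw [diagonal_apply_eq,
        Finset.sum_eq_single (c i) (fun j _ hj => (hD _ _ (hc i)).1 j hj) (by simp)]
      rfl
    · rw [diagonal_apply_ne _ h]
      exact (hD _ _ (hc i')).2 _ (hr.ne h)
  rw [← det_diagonal, ← this]
  exact det_submatrix_mem_detIdeal D r c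

/-- Convexity of the values of the ideals of minors over a valuation ring: there is a supporting
line at any size `t` for which some minor does not vanish. -/
theorem exists_mem_detIdeal_forall_dvd [IsDomain A] [ValuationRing A] {m : ℕ} {κ : Type*}
    [Fintype κ] (M : Matrix (Fin m) κ A) {t : ℕ} (ht : 0 < t) (htm : t ≤ m)
    (hM : M.detIdeal t ≠ ⊥) :
    ∃ g c : A, c ≠ 0 ∧ g ∈ M.detIdeal t ∧
      ∀ (s : ℕ), ∀ x ∈ M.detIdeal s, g * c ^ s ∣ x * c ^ t := by
  classical
  obtain ⟨D, hD, hDM⟩ := M.exists_isolatedRow_detIdeal_eq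
  let d : Fin m → A := fun i => ∑ j, D i j
  let f : Fin m → (Ideal A)ᵒᵈ := fun i => OrderDual.toDual (Ideal.span {d i})
  let e := Tuple.sort f
  have he : ∀ i j, i ≤ j → d (e i) ∣ d (e j) := fun i j hij =>
    Ideal.span_singleton_le_span_singleton.1 (Tuple.monotone_sort f hij)
  let l : Fin m := ⟨t - 1, by omega⟩
  let T : Finset (Fin m) := Finset.univ.map ((Fin.castLEEmb htm).trans e.toEmbedding)
  have hTmem : ∀ i, i ∈ T ↔ e.symm i ≤ l := fun i => by
    simp only [T, Finset.mem_map, Finset.mem_univ, true_and, l, Fin.le_def]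
    constructor
    · rintro ⟨a, rfl⟩
      simp; omega
    · intro h
      exact ⟨⟨e.symm i, by omega⟩, by simp⟩
  have hTcard : T.card = t := by simp [T]
  have hTc : ∀ i ∈ T, d i ∣ d (e l) := fun i hi => by
    simpa using he _ _ ((hTmem i).1 hi)
  have hTc' : ∀ i ∉ T, d (e l) ∣ d i := fun i hi => by
    simpa using he _ _ (le_of_lt (not_le.1 (mt (hTmem i).2 hi)))
  have hinj : ∀ {s : ℕ} (r : Fin s → Fin m), r.Injective →
      ∏ i, d (r i) = ∏ i ∈ Finset.univ.image r, d i := fun r hr => by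
    rw [Finset.prod_image (fun _ _ _ _ h => hr h)]
  refine ⟨∏ i ∈ T, d i, d (e l), fun h0 => hM ?_, ?_, fun s x hx => ?_⟩
  · rw [← hDM, eq_bot_iff, detIdeal, Ideal.span_le]
    rintro _ ⟨⟨r, c⟩, rfl⟩
    change _ = _
    by_cases hr : r.Injective
    · obtain ⟨i, hi⟩ : ∃ i, l ≤ e.symm (r i) := by
        by_contra hcon
        push Not at hcon
        have hc := Fintype.card_le_of_injective
          (fun i => (⟨e.symm (r i), Fin.lt_def.1 (hcon i)⟩ : Fin (t - 1)))
          (fun a b hab => hr (e.symm.injective (Fin.ext (by simpa using hab))))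
        simp at hc
        omega
      refine zero_dvd_iff.1 (dvd_trans ?_ (IsolatedRow.prod_dvd_det hD r c))
      have := he _ _ hi
      rw [h0, Equiv.apply_symm_apply] at this
      exact this.trans (Finset.dvd_prod_of_mem (fun i => d (r i)) (Finset.mem_univ i))
    · rw [Function.not_injective_iff] at hr
      obtain ⟨a, b, hab, hne⟩ := hr
      exact det_zero_of_row_eq hne (by ext; simp [hab])
  · rw [← hDM, Finset.prod_map]
    exact IsolatedRow.prod_mem_detIdeal hD _ ((Fin.castLEEmb htm).trans e.toEmbedding).injective
  · rw [← hDM] at hx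
    induction hx using Submodule.span_induction with
    | zero => simp
    | add x y _ _ h1 h2 => rw [add_mul]; exact dvd_add h1 h2
    | smul a x _ h => rw [smul_eq_mul, mul_assoc]; exact h.mul_left a
    | mem x hx =>
      obtain ⟨⟨r, c⟩, rfl⟩ := hx
      by_cases hr : r.Injective
      · have := Finset.prod_mul_pow_card_dvd d (d (e l)) (Finset.univ.image r) T hTc hTc'
        rw [hTcard, Finset.card_image_of_injective _ hr, Finset.card_fin, ← hinj r hr] at this
        exact this.trans (mul_dvd_mul_right (IsolatedRow.prod_dvd_det hD r c) _)
      · rw [Function.not_injective_iff] at hr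
        obtain ⟨a, b, hab, hne⟩ := hr
        have : (D.submatrix r c).det = 0 := det_zero_of_row_eq hne (by ext; simp [hab])
        simp [this]

end Matrix

/-- Valuative criterion for membership in the integral closure of an ideal. -/
theorem memIntClosure_of_forall_valuationSubring {R K : Type*} [CommRing R] [Field K]
    [Algebra R K] [FaithfulSMul R K] (J : Ideal R) (x : R) (hx : x ≠ 0)
    (h : ∀ (V : ValuationSubring K) (φ : R →+* V), (∀ r, (φ r : K) = algebraMap R K r) →
      φ x ∈ J.map φ) : MemIntClosure J x := by
  have hinj : Function.Injective (algebraMap R K) := FaithfulSMul.algebraMap_injective R K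
  have hx' : algebraMap R K x ≠ 0 := fun e => hx (hinj (by rw [e, map_zero]))
  let ev : Polynomial R →ₐ[R] K := Polynomial.aeval (algebraMap R K x)⁻¹
  let S : Subalgebra R K := (reesAlgebra J).map ev
  let I : Ideal S.toSubring :=
    { carrier := {y | ∃ q ∈ reesAlgebra J, q.coeff 0 = 0 ∧ ev q = y}
      zero_mem' := ⟨0, zero_mem _, by simp, by simp⟩
      add_mem' := by
        rintro a b ⟨q, hq, hq0, hqe⟩ ⟨q', hq', hq0', hqe'⟩
        exact ⟨q + q', add_mem hq hq', by simp [hq0, hq0'], by simp [hqe, hqe']⟩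
      smul_mem' := by
        rintro ⟨_, q, hq, rfl⟩ b ⟨q', hq', hq0', hqe'⟩
        exact ⟨q * q', mul_mem hq hq', by simp [Polynomial.mul_coeff_zero, hq0'], by
          rw [map_mul, hqe']; rfl⟩ }
  by_cases hI : I = ⊤
  · obtain ⟨q, hq, hq0, hqe⟩ : (1 : S.toSubring) ∈ I := hI ▸ Submodule.mem_top
    have hqe : ev q = 1 := hqe
    rw [mem_reesAlgebra_iff] at hq
    refine ⟨q.natDegree + 1, fun i => - q.coeff i, Nat.succ_pos _,
      fun i _ => neg_mem (hq i), hinj ?_⟩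
    have h1 : ∑ i ∈ Finset.range (q.natDegree + 1 + 1),
        algebraMap R K (q.coeff i) * (algebraMap R K x)⁻¹ ^ i = 1 := by
      rw [← hqe]
      simp only [ev]
      rw [Polynomial.aeval_eq_sum_range' (n := q.natDegree + 1 + 1) (by omega)]
      simp [Algebra.smul_def]
    rw [Finset.range_eq_Ico, Finset.sum_eq_sum_Ico_succ_bot (by omega), hq0] at h1
    have h2 : ∑ i ∈ Finset.Icc 1 (q.natDegree + 1),
        algebraMap R K (q.coeff i) * algebraMap R K x ^ (q.natDegree + 1 - i) =
        algebraMap R K x ^ (q.natDegree + 1) := by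
      have := congrArg (· * algebraMap R K x ^ (q.natDegree + 1)) h1
      simp only [map_zero, zero_mul, zero_add, one_mul, Finset.sum_mul] at this
      rw [← this]
      refine Finset.sum_congr (by ext; simp) fun i hi => ?_
      have hi' : i ≤ q.natDegree + 1 := by simp at hi; omega
      rw [mul_assoc, pow_sub₀ _ hx' hi', inv_pow, mul_comm (_ ^ (q.natDegree + 1))]
    simp [h2]
  · obtain ⟨V, hV, hVI⟩ := Ideal.image_subset_nonunits_valuationSubring I hI
    have hRV : ∀ r, algebraMap R K r ∈ V := fun r => hV (S.algebraMap_mem r)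
    let φ : R →+* V := (algebraMap R K).codRestrict V.toSubring hRV
    have hφ : ∀ r, (φ r : K) = algebraMap R K r := fun _ => rfl
    have hmem : ∀ y ∈ J.map φ, ((y : K) / algebraMap R K x) ∈ V.nonunits := by
      intro y hy
      induction hy using Submodule.span_induction with
      | zero => simp
      | add a b _ _ ha hb => rw [V.coe_add, add_div]; exact add_mem ha hb
      | smul a b _ hb =>
        rw [smul_eq_mul, V.coe_mul, mul_div_assoc]
        obtain ⟨hb', hb''⟩ := V.mem_nonunits_iff_exists_mem_maximalIdeal.1 hb
        exact V.mem_nonunits_iff_exists_mem_maximalIdeal.2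
          ⟨mul_mem a.2 hb', Ideal.mul_mem_left _ a hb''⟩
      | mem y hy =>
        obtain ⟨f, hf, rfl⟩ := hy
        have hfS : Polynomial.monomial 1 f ∈ reesAlgebra J :=
          reesAlgebra.monomial_mem.2 (by simpa using hf)
        have hev : ev (Polynomial.monomial 1 f) = algebraMap R K f / algebraMap R K x := by
          simp [ev, Polynomial.aeval_monomial, div_eq_mul_inv]
        refine hVI ⟨⟨_, ⟨Polynomial.monomial 1 f, hfS, hev⟩⟩,
          ⟨Polynomial.monomial 1 f, hfS, ?_, hev⟩, rfl⟩
        simp [Polynomial.coeff_monomial]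
    have := hmem _ (h V φ hφ)
    rw [hφ, div_self hx'] at this
    rw [V.mem_nonunits_iff, map_one] at this
    exact (lt_irrefl _ this).elim

section Minors

variable {𝔽 : Type*} [Field 𝔽] {m n : ℕ}

theorem exists_perm_strictMono_of_injective {s m : ℕ} (r : Fin s → Fin m)
    (hr : Function.Injective r) : ∃ σ : Equiv.Perm (Fin s), StrictMono (r ∘ σ) :=
  ⟨Tuple.sort r, (Tuple.monotone_sort r).strictMono_of_injective
    (hr.comp (Tuple.sort r).injective)⟩

theorem detIdeal_genMat_le (s : ℕ) : (genMat 𝔽 m n).detIdeal s ≤ minorsIdeal 𝔽 m n s := by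
  refine Ideal.span_le.2 ?_
  rintro _ ⟨⟨r, c⟩, rfl⟩
  simp only [SetLike.mem_coe]
  by_cases hr : r.Injective
  swap
  · rw [Function.not_injective_iff] at hr
    obtain ⟨a, b, hab, hne⟩ := hr
    rw [Matrix.det_zero_of_row_eq hne (by ext; simp [hab])]
    exact zero_mem _
  by_cases hc : c.Injective
  swap
  · rw [Function.not_injective_iff] at hc
    obtain ⟨a, b, hab, hne⟩ := hc
    rw [Matrix.det_zero_of_column_eq hne (by simp [hab])]
    exact zero_mem _
  obtain ⟨σ, hσ⟩ := exists_perm_strictMono_of_injective r hr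
  obtain ⟨τ, hτ⟩ := exists_perm_strictMono_of_injective c hc
  have hmem : ((genMat 𝔽 m n).submatrix (r ∘ σ) (c ∘ τ)).det ∈ minorsIdeal 𝔽 m n s :=
    Ideal.subset_span ⟨_, _, hσ, hτ, rfl⟩
  have hsub : (((genMat 𝔽 m n).submatrix r c).submatrix id τ).submatrix σ id =
      (genMat 𝔽 m n).submatrix (r ∘ σ) (c ∘ τ) := rfl
  rw [← hsub, Matrix.det_permute, Matrix.det_permute'] at hmem
  have hu : ∀ ρ : Equiv.Perm (Fin s), IsUnit (((Equiv.Perm.sign ρ : ℤˣ) : ℤ) :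
      MvPolynomial (Fin m × Fin n) 𝔽) := fun ρ =>
    (Equiv.Perm.sign ρ).isUnit.map (Int.castRingHom (MvPolynomial (Fin m × Fin n) 𝔽))
  rwa [Ideal.unit_mul_mem_iff_mem _ (hu _), Ideal.unit_mul_mem_iff_mem _ (hu _)] at hmem

theorem map_detIdeal {ι κ A B : Type*} [CommRing A] [CommRing B] (φ : A →+* B)
    (M : Matrix ι κ A) (s : ℕ) : (M.detIdeal s).map φ = (M.map φ).detIdeal s := by
  rw [Matrix.detIdeal, Matrix.detIdeal, Ideal.map_span, ← Set.range_comp]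
  congr 2
  ext q
  simp [RingHom.map_det, Matrix.submatrix_map]

theorem IsMinor.mem_detIdeal {s : ℕ} {f : MvPolynomial (Fin m × Fin n) 𝔽}
    (hf : IsMinor 𝔽 m n s f) : f ∈ (genMat 𝔽 m n).detIdeal s := by
  obtain ⟨r, c, -, -, rfl⟩ := hf
  exact Matrix.det_submatrix_mem_detIdeal _ _ _

theorem IsMinor.ne_zero {s : ℕ} {f : MvPolynomial (Fin m × Fin n) 𝔽}
    (hf : IsMinor 𝔽 m n s f) : f ≠ 0 := by
  obtain ⟨r, c, hr, hc, rfl⟩ := hf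
  have : (genMat 𝔽 m n).submatrix r c =
      (rename (Prod.map r c)).mapMatrix (Matrix.mvPolynomialX (Fin s) (Fin s) 𝔽) := by
    ext1 i j
    simp [genMat]
  rw [this, ← AlgHom.map_det]
  exact fun h => Matrix.det_mvPolynomialX_ne_zero (Fin s) 𝔽
    (rename_injective _ (hr.injective.prodMap hc.injective) (by rw [h, map_zero]))

theorem IsMinor.isHomogeneous {s : ℕ} {f : MvPolynomial (Fin m × Fin n) 𝔽}
    (hf : IsMinor 𝔽 m n s f) : f.IsHomogeneous s := by
  obtain ⟨r, c, -, -, rfl⟩ := hf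
  rw [Matrix.det_apply']
  refine IsHomogeneous.sum _ _ _ fun σ _ => ?_
  have h1 : (((Equiv.Perm.sign σ : ℤˣ) : ℤ) :
      MvPolynomial (Fin m × Fin n) 𝔽).IsHomogeneous 0 := by
    rw [← map_intCast (C : 𝔽 →+* MvPolynomial (Fin m × Fin n) 𝔽)]
    exact isHomogeneous_C _ _
  have h2 := IsHomogeneous.prod Finset.univ
    (fun i => (genMat 𝔽 m n).submatrix r c (σ i) i) (fun _ => 1) (fun i _ => isHomogeneous_X _ _)
  simpa using h1.mul h2

/-- `f` is a product of `h` minors whose sizes add up to `d`. -/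
def IsMinorProd (f : MvPolynomial (Fin m × Fin n) 𝔽) (h d : ℕ) : Prop :=
  ∃ l : List (ℕ × MvPolynomial (Fin m × Fin n) 𝔽), (∀ q ∈ l, IsMinor 𝔽 m n q.1 q.2) ∧
    (l.map Prod.snd).prod = f ∧ l.length = h ∧ (l.map Prod.fst).sum = d

theorem IsMinor.isMinorProd {s : ℕ} {f : MvPolynomial (Fin m × Fin n) 𝔽}
    (hf : IsMinor 𝔽 m n s f) : IsMinorProd f 1 s :=
  ⟨[(s, f)], by simpa using hf, by simp, by simp, by simp⟩

theorem isMinorProd_one : IsMinorProd (1 : MvPolynomial (Fin m × Fin n) 𝔽) 0 0 :=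
  ⟨[], by simp, by simp, by simp, by simp⟩

theorem IsMinorProd.mul {f f' : MvPolynomial (Fin m × Fin n) 𝔽} {h h' d d' : ℕ}
    (hf : IsMinorProd f h d) (hf' : IsMinorProd f' h' d') :
    IsMinorProd (f * f') (h + h') (d + d') := by
  obtain ⟨l, h1, rfl, rfl, rfl⟩ := hf
  obtain ⟨l', h1', rfl, rfl, rfl⟩ := hf'
  refine ⟨l ++ l', fun q hq => ?_, by simp, by simp, by simp⟩
  exact (List.mem_append.1 hq).elim (h1 q) (h1' q)

theorem IsMinorProd.pow {f : MvPolynomial (Fin m × Fin n) 𝔽} {h d : ℕ}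
    (hf : IsMinorProd f h d) (N : ℕ) : IsMinorProd (f ^ N) (N * h) (N * d) := by
  induction N with
  | zero => simpa using isMinorProd_one
  | succ N ih => simpa [pow_succ, add_mul] using ih.mul hf

theorem IsMinorProd.prod {σ : Type*} (S : Finset σ) (f : σ → MvPolynomial (Fin m × Fin n) 𝔽)
    (h d : σ → ℕ) (hf : ∀ i ∈ S, IsMinorProd (f i) (h i) (d i)) :
    IsMinorProd (∏ i ∈ S, f i) (∑ i ∈ S, h i) (∑ i ∈ S, d i) := by
  classical
  induction S using Finset.induction_on with
  | empty => simpa using isMinorProd_one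
  | insert a S ha ih =>
    rw [Finset.prod_insert ha, Finset.sum_insert ha, Finset.sum_insert ha]
    exact (hf a (by simp)).mul (ih fun i hi => hf i (by simp [hi]))

theorem IsMinorProd.isHomogeneous {f : MvPolynomial (Fin m × Fin n) 𝔽} {h d : ℕ}
    (hf : IsMinorProd f h d) : f.IsHomogeneous d := by
  obtain ⟨l, h1, rfl, -, rfl⟩ := hf
  induction l with
  | nil => simpa using isHomogeneous_one _ _
  | cons q l ih =>
    simp only [List.map_cons, List.prod_cons, List.sum_cons]
    exact (h1 q (by simp)).isHomogeneous.mul (ih fun q hq => h1 q (by simp [hq]))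

theorem IsMinorProd.ne_zero {f : MvPolynomial (Fin m × Fin n) 𝔽} {h d : ℕ}
    (hf : IsMinorProd f h d) : f ≠ 0 := by
  obtain ⟨l, h1, rfl, -, -⟩ := hf
  refine List.prod_ne_zero fun h0 => ?_
  obtain ⟨q, hq, hq0⟩ := List.mem_map.1 h0
  exact (h1 q hq).ne_zero hq0

theorem IsMinorProd.exists_fin {f : MvPolynomial (Fin m × Fin n) 𝔽} {h d : ℕ}
    (hf : IsMinorProd f h d) : ∃ (sz : Fin h → ℕ) (δ : Fin h → MvPolynomial (Fin m × Fin n) 𝔽),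
      (∀ i, IsMinor 𝔽 m n (sz i) (δ i)) ∧ f = ∏ i, δ i := by
  obtain ⟨l, h1, rfl, rfl, -⟩ := hf
  refine ⟨fun i => (l.get i).1, fun i => (l.get i).2, fun i => h1 _ (l.get_mem i), ?_⟩
  rw [← List.prod_ofFn]
  congr 1
  conv_lhs => rw [← List.ofFn_get l, List.map_ofFn]
  rfl

theorem isMinor_intervalMinor {s r c : ℕ} (hm : 0 < m) (hn : 0 < n) (hr : r + s ≤ m)
    (hc : c + s ≤ n) : IsMinor 𝔽 m n s (intervalMinor 𝔽 m n s r c) := by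
  refine ⟨fun i => ⟨r + i, by omega⟩, fun j => ⟨c + j, by omega⟩, fun i j hij => ?_,
    fun i j hij => ?_, ?_⟩
  · exact Fin.lt_def.2 (Nat.add_lt_add_left hij r)
  · exact Fin.lt_def.2 (Nat.add_lt_add_left hij c)
  · rw [intervalMinor, dif_pos ⟨hm, hn⟩]
    congr 1
    ext1 i j
    simp only [genMat, Matrix.of_apply, Matrix.submatrix_apply]
    congr 2 <;> ext <;> simp <;> omega

/-- A product of at most `N` minors whose sizes add up to `t * N` is integral over `I_t ^ N`. -/
theorem IsMinorProd.memIntClosure {f : MvPolynomial (Fin m × Fin n) 𝔽} {h N t : ℕ}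
    (ht : 0 < t) (htm : t ≤ m) (hmn : m ≤ n) (hf : IsMinorProd f h (t * N)) (hN : h ≤ N) :
    MemIntClosure (minorsIdeal 𝔽 m n t ^ N) f := by
  refine memIntClosure_of_forall_valuationSubring
    (K := FractionRing (MvPolynomial (Fin m × Fin n) 𝔽)) _ f hf.ne_zero fun V φ hφ => ?_
  have hφinj : Function.Injective φ := fun a b hab =>
    IsFractionRing.injective (MvPolynomial (Fin m × Fin n) 𝔽) _ (by rw [← hφ, ← hφ, hab])
  have hmap : ∀ {s : ℕ} {x : MvPolynomial (Fin m × Fin n) 𝔽}, IsMinor 𝔽 m n s x →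
      φ x ∈ ((genMat 𝔽 m n).map φ).detIdeal s := fun hx => by
    rw [← map_detIdeal]
    exact Ideal.mem_map_of_mem φ hx.mem_detIdeal
  have ht0 : IsMinor 𝔽 m n t (intervalMinor 𝔽 m n t 0 0) :=
    isMinor_intervalMinor (by omega) (by omega) (by omega) (by omega)
  obtain ⟨g, c, hc, hg, hdvd⟩ := ((genMat 𝔽 m n).map φ).exists_mem_detIdeal_forall_dvd ht htm
    fun hbot => ht0.ne_zero (hφinj (by
      have := hmap ht0
      rwa [hbot, Ideal.mem_bot, ← map_zero φ] at this))
  have hgc : g ∣ c ^ t := by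
    have h1 : (1 : V) ∈ ((genMat 𝔽 m n).map φ).detIdeal 0 := by
      simpa using ((genMat 𝔽 m n).map φ).det_submatrix_mem_detIdeal Fin.elim0 Fin.elim0
    simpa using hdvd 0 1 h1
  obtain ⟨l, hl, rfl, rfl, hd⟩ := hf
  have hprod : g ^ l.length * c ^ (l.map Prod.fst).sum ∣
      φ (l.map Prod.snd).prod * (c ^ t) ^ l.length := by
    clear hd hN
    induction l with
    | nil => simp
    | cons q l ih =>
      have h1 := hdvd _ _ (hmap (hl q (by simp)))
      have h2 := ih fun q hq => hl q (by simp [hq])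
      have h3 := mul_dvd_mul h1 h2
      simp only [List.length_cons, List.map_cons, List.sum_cons, List.prod_cons, map_mul]
      convert h3 using 1 <;> ring
  have hgN : g ^ N ∣ φ (l.map Prod.snd).prod := by
    obtain ⟨e, rfl⟩ := Nat.exists_eq_add_of_le hN
    rw [hd, mul_add, pow_add, pow_mul, pow_mul, ← mul_assoc, mul_right_comm] at hprod
    have h4 := (mul_dvd_mul_iff_right (pow_ne_zero _ (pow_ne_zero _ hc))).1 hprod
    rw [pow_add]
    exact (mul_dvd_mul_left _ (pow_dvd_pow_of_dvd hgc e)).trans h4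
  refine Ideal.mem_of_dvd _ hgN ?_
  rw [Ideal.map_pow]
  refine Ideal.pow_mem_pow (Ideal.map_mono (detIdeal_genMat_le t) ?_) N
  rwa [map_detIdeal]

end Minors

theorem sum_Icc_two_mul_sub {m b : ℕ} (hb : b + 1 ≤ m) :
    ((∑ j ∈ Finset.Icc 2 (b + 1), ((m - j + 1) + (m - j + 1)) : ℕ) : ℤ) =
      b * (2 * m - b - 1) := by
  induction b with
  | zero => simp
  | succ b ih =>
    rw [Finset.sum_Icc_succ_top (by omega), Nat.cast_add, ih (by omega)]
    obtain ⟨e, rfl⟩ := Nat.exists_eq_add_of_le hb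
    have : b + 1 + 1 + e - (b + 1 + 1) = e := by omega
    rw [this]
    push_cast
    ring

section MinorCount

variable (𝔽 : Type*) [Field 𝔽] {m n k t : ℕ}

theorem isMinorProd_Delta (hkm : k < m) (hmn : m ≤ n) :
    ∃ h d : ℕ, IsMinorProd (Delta 𝔽 m n k) h d ∧ (h : ℤ) = m + n - 2 * k - 1 ∧
      (d : ℤ) = m * n - k * (k + 1) := by
  have h1 := IsMinorProd.prod (Finset.range (n - m + 1)) (fun i => intervalMinor 𝔽 m n m 0 i)
    (fun _ => 1) (fun _ => m) fun i hi => (isMinor_intervalMinor (by omega) (by omega)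
      (by omega) (by have := Finset.mem_range.1 hi; omega)).isMinorProd
  have h2 := IsMinorProd.prod (Finset.Icc 2 (m - k))
    (fun j => intervalMinor 𝔽 m n (m - j + 1) (j - 1) 0 *
      intervalMinor 𝔽 m n (m - j + 1) 0 (n - m + j - 1))
    (fun _ => 1 + 1) (fun j => (m - j + 1) + (m - j + 1)) fun j hj => by
      have := Finset.mem_Icc.1 hj
      exact IsMinorProd.mul
        (isMinor_intervalMinor (by omega) (by omega) (by omega) (by omega)).isMinorProd
        (isMinor_intervalMinor (by omega) (by omega) (by omega) (by omega)).isMinorProd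
  refine ⟨_, _, h1.mul h2, ?_, ?_⟩
  · simp
    omega
  · obtain ⟨a, rfl⟩ := Nat.exists_eq_add_of_lt hkm
    obtain ⟨e, rfl⟩ := Nat.exists_eq_add_of_le hmn
    have e1 : k + a + 1 - k = a + 1 := by omega
    rw [e1, Nat.cast_add, sum_Icc_two_mul_sub (by omega)]
    simp
    ring

theorem isMinorProd_Delta' (hkm : k < m) (hmn : m ≤ n) :
    ∃ h d : ℕ, IsMinorProd (Delta' 𝔽 m n k) h d ∧ (h : ℤ) = m + n - 2 * k ∧
      (d : ℤ) = m * n - k ^ 2 := by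
  obtain ⟨h, d, hΔ, hh, hd⟩ := isMinorProd_Delta 𝔽 hkm hmn
  refine ⟨_, _, hΔ.mul (isMinor_intervalMinor (s := k) (r := m - k) (c := 0)
    (by omega) (by omega) (by omega) (by omega)).isMinorProd, ?_, ?_⟩
  · push_cast; linarith
  · push_cast; linarith

theorem minCond_iff (hkt : k < t) (htm : t ≤ m) (hmn : m ≤ n) :
    minCond t m n k ↔
      ((t : ℤ) - k) * (m + n - 2 * k - 1) ≤ ((m : ℤ) - k) * (n - k) := by
  obtain ⟨T, rfl⟩ := Nat.exists_eq_add_of_lt hkt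
  obtain ⟨M, rfl⟩ := Nat.exists_eq_add_of_le htm
  obtain ⟨N, rfl⟩ := Nat.exists_eq_add_of_le hmn
  rcases Nat.eq_zero_or_pos T with rfl | hT
  · refine iff_of_true (Or.inl (by omega)) ?_
    push_cast
    nlinarith [mul_nonneg (Nat.cast_nonneg (α := ℤ) M) (Nat.cast_nonneg (α := ℤ) M),
      mul_nonneg (Nat.cast_nonneg (α := ℤ) M) (Nat.cast_nonneg (α := ℤ) N)]
  · have e1 : k + T + 1 + M - k = T + 1 + M := by omega
    have e2 : k + T + 1 + M + N - k = T + 1 + M + N := by omega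
    have e3 : k + T + 1 - k = T + 1 := by omega
    have e4 : T + 1 + M - 1 = T + M := by omega
    have e5 : T + 1 + M + N - 1 = T + M + N := by omega
    have e6 : T + 1 - 1 = T := by omega
    rw [minCond, or_iff_right (by omega), e1, e2, e3, e4, e5, e6,
      div_le_div_iff₀ (by positivity) (by positivity)]
    rw [← Nat.cast_mul, ← Nat.cast_mul, Nat.cast_le, ← Nat.cast_le (α := ℤ)]
    push_cast
    constructor <;> intro h <;> linarith

/-- The element `Δ` is a product of at most `(m - k) * (n - k)` minors, of total size
`t * ((m - k) * (n - k))`. -/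
theorem isMinorProd_DeltaMain (hkt : k < t) (htm : t ≤ m) (hmn : m ≤ n)
    (hCk : minCond t m n k) (hleast : ∀ j : ℕ, j < k → ¬ minCond t m n j) :
    ∃ h ≤ (m - k) * (n - k),
      IsMinorProd (DeltaMain 𝔽 m n t k) h (t * ((m - k) * (n - k))) := by
  rw [minCond_iff hkt htm hmn] at hCk
  have hkm : k < m := by omega
  have hcast : ((m - k : ℕ) : ℤ) * ((n - k : ℕ) : ℤ) = ((m : ℤ) - k) * (n - k) := by
    rw [Nat.cast_sub (by omega), Nat.cast_sub (by omega)]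
  obtain ⟨h, d, hΔ, hh, hd⟩ := isMinorProd_Delta 𝔽 hkm hmn
  obtain ⟨h', d', hΔ', hh', hd'⟩ := isMinorProd_Delta' 𝔽 hkm hmn
  by_cases hk0 : k = 0
  · subst hk0
    rw [DeltaMain, if_pos rfl]
    refine ⟨t * h, ?_, ?_⟩
    · zify
      rw [hcast, hh]
      simpa using hCk
    · convert hΔ.pow t using 1
      zify
      rw [hcast, hd]
      simp
  rw [DeltaMain, if_neg hk0]
  split_ifs with hu
  · have hle : 0 ≤ (t : ℤ) - k - uInt t m n k := by
      rw [uInt]; nlinarith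
    refine ⟨(uInt t m n k).toNat * h + ((t : ℤ) - k - uInt t m n k).toNat * h', ?_, ?_⟩
    · zify
      rw [hcast, hh, hh', Int.toNat_of_nonneg hu, Int.toNat_of_nonneg hle, uInt]
      exact le_of_eq (by ring)
    · convert (hΔ.pow (uInt t m n k).toNat).mul
        (hΔ'.pow ((t : ℤ) - k - uInt t m n k).toNat) using 1
      zify
      rw [hcast, hd, hd', Int.toNat_of_nonneg hu, Int.toNat_of_nonneg hle, uInt]
      ring
  · have hprev := hleast (k - 1) (by omega)
    rw [minCond_iff (by omega) htm hmn, Nat.cast_sub (by omega)] at hprev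
    obtain ⟨h₁, d₁, hΔ₁, hh₁, hd₁⟩ := isMinorProd_Delta 𝔽 (k := k - 1) (by omega) hmn
    rw [Nat.cast_sub (by omega)] at hh₁ hd₁
    have hle : 0 ≤ (t : ℤ) - k + uInt t m n k := by
      rw [uInt]; push_cast at hprev; nlinarith
    have hu' : 0 ≤ -uInt t m n k := by omega
    refine ⟨((t : ℤ) - k + uInt t m n k).toNat * h' + (-uInt t m n k).toNat * h₁, ?_, ?_⟩
    · zify
      rw [hcast, hh₁, hh', Int.toNat_of_nonneg hu', Int.toNat_of_nonneg hle, uInt]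
      exact le_of_eq (by push_cast; ring)
    · convert (hΔ'.pow ((t : ℤ) - k + uInt t m n k).toNat).mul
        (hΔ₁.pow (-uInt t m n k).toNat) using 1
      zify
      rw [hcast, hd₁, hd', Int.toNat_of_nonneg hu', Int.toNat_of_nonneg hle, uInt]
      push_cast
      ring

end MinorCount

/-- Let `k` be the least integer in `[0, t-1]` with
`(m-k)(n-k)/(t-k) ≤ (m-k-1)(n-k-1)/(t-k-1)` (division by zero read as infinity), and let
`Δ` be as constructed above.  Then `Δ` has degree `t(m-k)(n-k)`, `Δ` is a product of at
most `(m-k)(n-k)` minors, and `Δ` lies in the integral closure of `I_t^{(m-k)(n-k)}`. -/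
theorem Delta_mem_integralClosure (p : ℕ) (hp : p.Prime)
    (𝔽 : Type*) [Field 𝔽] [CharP 𝔽 p]
    (m n t : ℕ) (ht : 0 < t) (htm : t ≤ m) (hmn : m ≤ n)
    (k : ℕ) (hk : k ≤ t - 1) (hCk : minCond t m n k)
    (hleast : ∀ j : ℕ, j < k → ¬ minCond t m n j) :
    (DeltaMain 𝔽 m n t k).totalDegree = t * ((m - k) * (n - k)) ∧
    (∃ (h : ℕ) (sz : Fin h → ℕ) (δ : Fin h → MvPolynomial (Fin m × Fin n) 𝔽),
      h ≤ (m - k) * (n - k) ∧ (∀ i, IsMinor 𝔽 m n (sz i) (δ i)) ∧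
        DeltaMain 𝔽 m n t k = ∏ i, δ i) ∧
    MemIntClosure (minorsIdeal 𝔽 m n t ^ ((m - k) * (n - k))) (DeltaMain 𝔽 m n t k) := by
  obtain ⟨h, hh, hΔ⟩ := isMinorProd_DeltaMain 𝔽 (by omega) htm hmn hCk hleast
  obtain ⟨sz, δ, hδ, he⟩ := hΔ.exists_fin
  exact ⟨hΔ.isHomogeneous.totalDegree hΔ.ne_zero, ⟨h, sz, δ, hh, hδ, he⟩,
    hΔ.memIntClosure ht htm hmn hh⟩
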